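/- arXiv:2310.13728 — 6 statements merged into one kernel-verified Lean document; each statement's English description precedes it below -/
import Mathlib

section
/- A linear map A: h → g is a κ-weighted O-operator from a Hom-Lie triple system h to a Hom-Lie triple system g with respect to an action θ if and only if the block operator N_A = (id, A; 0, 0) on g ⊕ h (sending x+u to x + A(u) in the g component and 0 in the h component) is a Nijenhuis operator on the semidirect product Hom-Lie triple system g ⋉_θ h. -/
open Finset

section Defs

variable (K : Type*) [Field K]
variable {g h V : Type*} [AddCommGroup g] [Module K g] [AddCommGroup h] [Module K h]
  [AddCommGroup V] [Module K V]

/-- A Hom-Lie triple system structure: multiplicativity of the twist, antisymmetry in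
the first two slots, the cyclic identity, and the Hom-fundamental identity. -/
def IsHomLts (br : g →ₗ[K] g →ₗ[K] g →ₗ[K] g) (α : g →ₗ[K] g) : Prop :=
  (∀ x y z, α (br x y z) = br (α x) (α y) (α z)) ∧
  (∀ x y z, br x y z + br y x z = 0) ∧
  (∀ x y z, br x y z + br z x y + br y z x = 0) ∧
  (∀ a b x y z, br (α a) (α b) (br x y z) =
    br (br a b x) (α y) (α z) + br (α x) (br a b y) (α z) + br (α x) (α y) (br a b z))

/-- Representation of a Hom-Lie triple system on a Hom-vector space `(V, β)`.
Here `D x y = θ y x - θ x y`. -/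
def IsRep (brg : g →ₗ[K] g →ₗ[K] g →ₗ[K] g) (αg : g →ₗ[K] g)
    (θ : g →ₗ[K] g →ₗ[K] Module.End K V) (β : V →ₗ[K] V) : Prop :=
  (∀ x y v, θ (αg x) (αg y) (β v) = β (θ x y v)) ∧
  (∀ a b x y v, θ (αg a) (αg b) (θ x y v) - θ (αg y) (αg b) (θ x a v)
    - θ (αg x) (brg y a b) (β v)
    + (θ (αg a) (αg y) (θ x b v) - θ (αg y) (αg a) (θ x b v)) = 0) ∧
  (∀ a b x y v, θ (αg a) (αg b) (θ y x v) - θ (αg a) (αg b) (θ x y v)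
    - (θ (αg y) (αg x) (θ a b v) - θ (αg x) (αg y) (θ a b v))
    + θ (brg x y a) (αg b) (β v) + θ (αg a) (brg x y b) (β v) = 0)

/-- Action of a Hom-Lie triple system `(g, brg, αg)` on another Hom-Lie triple system
`(h, brh, αh)`. -/
def IsAction (brg : g →ₗ[K] g →ₗ[K] g →ₗ[K] g) (αg : g →ₗ[K] g)
    (brh : h →ₗ[K] h →ₗ[K] h →ₗ[K] h) (αh : h →ₗ[K] h)
    (θ : g →ₗ[K] g →ₗ[K] Module.End K h) : Prop :=
  IsRep K brg αg θ αh ∧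
  (∀ x y u v w, θ (αg x) (αg y) (brh u v w) =
    brh (θ x y u) (αh v) (αh w) + brh (αh u) (θ x y v) (αh w)
      + brh (αh u) (αh v) (θ x y w)) ∧
  (∀ x y u v w, θ (αg x) (αg y) (brh u v w) = 0) ∧
  (∀ x y u v w, brh (αh u) (αh v) (θ x y w) = 0)

/-- `A : h → g` is a `κ`-weighted `𝒪`-operator with respect to the action `θ`:
`A ∘ αh = αg ∘ A` and
`[Au,Av,Aw]_g = A(D(Au,Av)w - θ(Au,Aw)v + θ(Av,Aw)u + κ[u,v,w]_h)`. -/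
def IsOOperator (brg : g →ₗ[K] g →ₗ[K] g →ₗ[K] g) (αg : g →ₗ[K] g)
    (brh : h →ₗ[K] h →ₗ[K] h →ₗ[K] h) (αh : h →ₗ[K] h)
    (θ : g →ₗ[K] g →ₗ[K] Module.End K h) (κ : K) (A : h →ₗ[K] g) : Prop :=
  (∀ u, A (αh u) = αg (A u)) ∧
  (∀ u v w, brg (A u) (A v) (A w) =
    A (θ (A v) (A u) w - θ (A u) (A v) w - θ (A u) (A w) v + θ (A v) (A w) u
      + κ • brh u v w))

/-- The semidirect product bracket on `g × h`:
`[x+u,y+v,z+w] = [x,y,z]_g + D(x,y)w - θ(x,z)v + θ(y,z)u + κ[u,v,w]_h`. -/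
def sdBr (brg : g →ₗ[K] g →ₗ[K] g →ₗ[K] g)
    (brh : h →ₗ[K] h →ₗ[K] h →ₗ[K] h)
    (θ : g →ₗ[K] g →ₗ[K] Module.End K h) (κ : K) :
    (g × h) →ₗ[K] (g × h) →ₗ[K] (g × h) →ₗ[K] (g × h) :=
  LinearMap.mk₂ K (fun a b =>
    { toFun := fun c =>
        (brg a.1 b.1 c.1,
         θ b.1 a.1 c.2 - θ a.1 b.1 c.2 - θ a.1 c.1 b.2 + θ b.1 c.1 a.2
           + κ • brh a.2 b.2 c.2)
      map_add' := by
        intro c d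
        ext
        · simp [map_add]
        · simp [map_add, smul_add]
          abel
      map_smul' := by
        intro r c
        ext
        · simp
        · simp [map_smul, smul_sub, smul_add, smul_comm r κ] })
    (by
      intro a a' b
      refine LinearMap.ext fun c => Prod.ext ?_ ?_ <;> dsimp <;>
        simp only [Prod.fst_add, Prod.snd_add, map_add, LinearMap.add_apply, smul_add] <;> abel)
    (by
      intro r a b
      refine LinearMap.ext fun c => Prod.ext ?_ ?_ <;> dsimp <;>
        simp [map_smul, smul_sub, smul_add, smul_comm r κ])
    (by
      intro a b b'
      refine LinearMap.ext fun c => Prod.ext ?_ ?_ <;> dsimp <;>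
        simp only [Prod.fst_add, Prod.snd_add, map_add, LinearMap.add_apply, smul_add] <;> abel)
    (by
      intro r a b
      refine LinearMap.ext fun c => Prod.ext ?_ ?_ <;> dsimp <;>
        simp [map_smul, smul_sub, smul_add, smul_comm r κ])



/-- The descent bracket `{u,v,w}_A = D(Au,Av)w - θ(Au,Aw)v + θ(Av,Aw)u + κ[u,v,w]_h` on `h`. -/
def brA (brh : h →ₗ[K] h →ₗ[K] h →ₗ[K] h) (θ : g →ₗ[K] g →ₗ[K] Module.End K h)
    (κ : K) (A : h →ₗ[K] g) : h →ₗ[K] h →ₗ[K] h →ₗ[K] h :=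
  LinearMap.mk₂ K (fun u v =>
    { toFun := fun w => θ (A v) (A u) w - θ (A u) (A v) w - θ (A u) (A w) v
        + θ (A v) (A w) u + κ • brh u v w
      map_add' := by
        intro w w'
        simp only [map_add, LinearMap.add_apply, smul_add]
        abel
      map_smul' := by
        intro r w
        simp [map_smul, smul_sub, smul_add, smul_comm r κ] })
    (by
      intro u u' v
      refine LinearMap.ext fun w => ?_
      dsimp
      simp only [map_add, LinearMap.add_apply, smul_add]
      abel)
    (by
      intro r u v
      refine LinearMap.ext fun w => ?_
      dsimp
      simp [map_smul, smul_sub, smul_add, smul_comm r κ])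
    (by
      intro u v v'
      refine LinearMap.ext fun w => ?_
      dsimp
      simp only [map_add, LinearMap.add_apply, smul_add]
      abel)
    (by
      intro r u v
      refine LinearMap.ext fun w => ?_
      dsimp
      simp [map_smul, smul_sub, smul_add, smul_comm r κ])

/-- The induced representation `θ_A(u,v)x = [x,Au,Av]_g + A(θ(x,Av)u - D(x,Au)v)` of the
descent Hom-Lie triple system on `(g, αg)`. -/
def thetaA (brg : g →ₗ[K] g →ₗ[K] g →ₗ[K] g) (θ : g →ₗ[K] g →ₗ[K] Module.End K h)
    (A : h →ₗ[K] g) : h →ₗ[K] h →ₗ[K] Module.End K g :=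
  LinearMap.mk₂ K (fun u v =>
    { toFun := fun x => brg x (A u) (A v) + A (θ x (A v) u - θ (A u) x v + θ x (A u) v)
      map_add' := by
        intro x x'
        simp only [map_add, LinearMap.add_apply, map_sub, LinearMap.sub_apply]
        abel
      map_smul' := by
        intro r x
        simp [map_smul, smul_sub, smul_add] })
    (by
      intro u u' v
      refine LinearMap.ext fun x => ?_
      dsimp
      simp only [map_add, LinearMap.add_apply, map_sub, LinearMap.sub_apply]
      abel)
    (by
      intro r u v
      refine LinearMap.ext fun x => ?_
      dsimp
      simp [map_smul, smul_sub, smul_add])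
    (by
      intro u v v'
      refine LinearMap.ext fun x => ?_
      dsimp
      simp only [map_add, LinearMap.add_apply, map_sub, LinearMap.sub_apply]
      abel)
    (by
      intro r u v
      refine LinearMap.ext fun x => ?_
      dsimp
      simp [map_smul, smul_sub, smul_add])

/-- Nijenhuis operator on a Hom-Lie triple system. -/
def IsNijenhuis {M : Type*} [AddCommGroup M] [Module K M]
    (br : M →ₗ[K] M →ₗ[K] M →ₗ[K] M) (α N : M →ₗ[K] M) : Prop :=
  (∀ x, N (α x) = α (N x)) ∧
  (∀ x y z, br (N x) (N y) (N z) =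
    N (br x (N y) (N z) + br (N x) y (N z) + br (N x) (N y) z)
      - N (N (br (N x) y z + br x (N y) z + br x y (N z)))
      + N (N (N (br x y z))))

/-- Triples of natural numbers summing to `l`. -/
def triples (l : ℕ) : Finset (ℕ × ℕ × ℕ) :=
  ((range (l+1)) ×ˢ (range (l+1)) ×ˢ (range (l+1))).filter
    (fun p => p.1 + p.2.1 + p.2.2 = l)

/-- `𝒜 = (A_i)` with `A_i = 0` for `i > n` is an `n`-order deformation of `A = 𝒜 0`:
every coefficient of `t^l`, `l ≤ n`, of the weighted `𝒪`-operator identity for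
`A_t = Σ t^i A_i` vanishes. -/
def IsNOrderDef (brg : g →ₗ[K] g →ₗ[K] g →ₗ[K] g) (αg : g →ₗ[K] g)
    (brh : h →ₗ[K] h →ₗ[K] h →ₗ[K] h) (αh : h →ₗ[K] h)
    (θ : g →ₗ[K] g →ₗ[K] Module.End K h) (κ : K) (n : ℕ)
    (𝒜 : ℕ → (h →ₗ[K] g)) : Prop :=
  (∀ i, n < i → 𝒜 i = 0) ∧
  (∀ i u, 𝒜 i (αh u) = αg (𝒜 i u)) ∧
  (∀ l ≤ n, ∀ u v w : h,
    (∑ p ∈ triples l, brg (𝒜 p.1 u) (𝒜 p.2.1 v) (𝒜 p.2.2 w))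
    = (∑ p ∈ triples l, 𝒜 p.1
        (θ (𝒜 p.2.2 v) (𝒜 p.2.1 u) w - θ (𝒜 p.2.1 u) (𝒜 p.2.2 v) w
          - θ (𝒜 p.2.1 u) (𝒜 p.2.2 w) v + θ (𝒜 p.2.1 v) (𝒜 p.2.2 w) u))
      + κ • 𝒜 l (brh u v w))

/-- `{u,v,w}_D = {w,v,u} - {w,u,v}`. -/
def pD (tb : h →ₗ[K] h →ₗ[K] h →ₗ[K] h) (u v w : h) : h := tb w v u - tb w u v

/-- `⟨u,v,w⟩_C = {u,v,w}_D + {u,v,w} - {v,u,w} + ⌊u,v,w⌋`. -/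
def pC (lb tb : h →ₗ[K] h →ₗ[K] h →ₗ[K] h) (u v w : h) : h :=
  pD K tb u v w + tb u v w - tb v u w + lb u v w

/-- Hom-post-Lie triple system `(h, ⌊-,-,-⌋ = lb, {-,-,-} = tb, α)`. -/
def IsHomPostLts (lb tb : h →ₗ[K] h →ₗ[K] h →ₗ[K] h) (α : h →ₗ[K] h) : Prop :=
  IsHomLts K lb α ∧
  (∀ u v w, α (tb u v w) = tb (α u) (α v) (α w)) ∧
  (∀ u v w s t, tb (α u) (α v) (pC K lb tb w s t) =
    tb (tb u v w) (α s) (α t) - tb (tb u v s) (α w) (α t)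
      + pD K tb (α w) (α s) (tb u v t)) ∧
  (∀ u v w s t, pD K tb (α u) (α v) (tb w s t) =
    tb (pD K tb u v w) (α s) (α t) + tb (α w) (pC K lb tb u v s) (α t)
      + tb (α w) (α s) (pC K lb tb u v t)) ∧
  (∀ u v w s t, tb (lb w s t) (α u) (α v) = 0) ∧
  (∀ u v w s t, lb (α s) (α t) (tb w u v) = 0)

/-- The adjacent bracket `⟨u,v,w⟩_C` of a Hom-post-Lie triple system, as a trilinear map. -/
def cBr (lb tb : h →ₗ[K] h →ₗ[K] h →ₗ[K] h) : h →ₗ[K] h →ₗ[K] h →ₗ[K] h :=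
  LinearMap.mk₂ K (fun u v =>
    { toFun := fun w => tb w v u - tb w u v + tb u v w - tb v u w + lb u v w
      map_add' := by
        intro w w'
        simp only [map_add, LinearMap.add_apply]
        abel
      map_smul' := by
        intro r w
        simp [map_smul, smul_sub, smul_add] })
    (by
      intro u u' v
      refine LinearMap.ext fun w => ?_
      dsimp
      simp only [map_add, LinearMap.add_apply]
      abel)
    (by
      intro r u v
      refine LinearMap.ext fun w => ?_
      dsimp
      simp [map_smul, smul_sub, smul_add])
    (by
      intro u v v'
      refine LinearMap.ext fun w => ?_
      dsimp
      simp only [map_add, LinearMap.add_apply]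
      abel)
    (by
      intro r u v
      refine LinearMap.ext fun w => ?_
      dsimp
      simp [map_smul, smul_sub, smul_add])

/-- The map `𝔑(u,v)(w) = {w,u,v}` as a bilinear map into `End h`. -/
def nAct (tb : h →ₗ[K] h →ₗ[K] h →ₗ[K] h) : h →ₗ[K] h →ₗ[K] Module.End K h :=
  LinearMap.mk₂ K (fun u v =>
    { toFun := fun w => tb w u v
      map_add' := by intro w w'; simp [map_add]
      map_smul' := by intro r w; simp [map_smul] })
    (by
      intro u u' v
      refine LinearMap.ext fun w => ?_
      dsimp
      simp [map_add])
    (by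
      intro r u v
      refine LinearMap.ext fun w => ?_
      dsimp
      simp [map_smul])
    (by
      intro u v v'
      refine LinearMap.ext fun w => ?_
      dsimp
      simp [map_add])
    (by
      intro r u v
      refine LinearMap.ext fun w => ?_
      dsimp
      simp [map_smul])

/-- The ternary product `{u,v,w} = θ(Av,Aw)u` induced by a weighted `𝒪`-operator. -/
def postTb (θ : g →ₗ[K] g →ₗ[K] Module.End K h) (A : h →ₗ[K] g) :
    h →ₗ[K] h →ₗ[K] h →ₗ[K] h :=
  LinearMap.mk₂ K (fun u v =>
    { toFun := fun w => θ (A v) (A w) u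
      map_add' := by intro w w'; simp [map_add]
      map_smul' := by intro r w; simp [map_smul] })
    (by
      intro u u' v
      refine LinearMap.ext fun w => ?_
      dsimp
      simp [map_add])
    (by
      intro r u v
      refine LinearMap.ext fun w => ?_
      dsimp
      simp [map_smul])
    (by
      intro u v v'
      refine LinearMap.ext fun w => ?_
      dsimp
      simp [map_add])
    (by
      intro r u v
      refine LinearMap.ext fun w => ?_
      dsimp
      simp [map_smul])

/-- Hom-Lie algebra `(g, br, α)`. -/
def IsHomLie (br : g →ₗ[K] g →ₗ[K] g) (α : g →ₗ[K] g) : Prop :=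
  (∀ x y, br x y = - br y x) ∧
  (∀ x y, α (br x y) = br (α x) (α y)) ∧
  (∀ x y z, br (α x) (br y z) + br (α y) (br z x) + br (α z) (br x y) = 0)

/-- The ternary bracket `[x,y,z] = [[x,y], α(z)]` induced by a Hom-Lie algebra. -/
def trBr (br : g →ₗ[K] g →ₗ[K] g) (α : g →ₗ[K] g) : g →ₗ[K] g →ₗ[K] g →ₗ[K] g :=
  LinearMap.mk₂ K (fun x y => br (br x y) ∘ₗ α)
    (by intro x x' y; ext z; simp [map_add])
    (by intro r x y; ext z; simp [map_smul])
    (by intro x y y'; ext z; simp [map_add])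
    (by intro r x y; ext z; simp [map_smul])

/-- `θ_ρ(x,y) = ρ(α(y)) ∘ ρ(x)`. -/
def thetaRho (αg : g →ₗ[K] g) (ρ : g →ₗ[K] Module.End K h) :
    g →ₗ[K] g →ₗ[K] Module.End K h :=
  LinearMap.mk₂ K (fun x y => ρ (αg y) ∘ₗ ρ x)
    (by intro x x' y; ext u; simp [map_add])
    (by intro r x y; ext u; simp [map_smul])
    (by intro x y y'; ext u; simp [map_add])
    (by intro r x y; ext u; simp [map_smul])

/-- Action of a Hom-Lie algebra `(g, brg, αg)` on another Hom-Lie algebra `(h, brh, αh)`. -/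
def IsLieAction (brg : g →ₗ[K] g →ₗ[K] g) (αg : g →ₗ[K] g)
    (brh : h →ₗ[K] h →ₗ[K] h) (αh : h →ₗ[K] h)
    (ρ : g →ₗ[K] Module.End K h) : Prop :=
  (∀ x u, ρ (αg x) (αh u) = αh (ρ x u)) ∧
  (∀ x y u, ρ (brg x y) (αh u) = ρ (αg x) (ρ y u) - ρ (αg y) (ρ x u)) ∧
  (∀ x u v, ρ (αg x) (brh u v) = brh (ρ x u) (αh v) + brh (αh u) (ρ x v)) ∧
  (∀ x u v, brh (ρ x u) (αh v) = 0)

/-- `κ`-weighted `𝒪`-operator between Hom-Lie algebras with respect to an action `ρ`. -/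
def IsLieOOperator (brg : g →ₗ[K] g →ₗ[K] g) (αg : g →ₗ[K] g)
    (brh : h →ₗ[K] h →ₗ[K] h) (αh : h →ₗ[K] h)
    (ρ : g →ₗ[K] Module.End K h) (κ : K) (A : h →ₗ[K] g) : Prop :=
  (∀ u, A (αh u) = αg (A u)) ∧
  (∀ u v, brg (A u) (A v) = A (ρ (A u) v - ρ (A v) u + κ • brh u v))

/-- Hom-post-Lie algebra `(h, br, ⋆ = star, α)`. -/
def IsHomPostLie (br star : h →ₗ[K] h →ₗ[K] h) (α : h →ₗ[K] h) : Prop :=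
  IsHomLie K br α ∧
  (∀ u v, α (star u v) = star (α u) (α v)) ∧
  (∀ u v w, star (α u) (br v w) = br (star u v) (α w) + br (α v) (star u w)) ∧
  (∀ u v w, star (br u v + star u v - star v u) (α w)
      = star (α u) (star v w) - star (α v) (star u w)) ∧
  (∀ u v w, star (α u) (br v w) = 0) ∧
  (∀ u v w, br (star u v) (α w) = 0)

/-- The adjacent Hom-Lie bracket `[u,v]_C = u⋆v - v⋆u + [u,v]` of a Hom-post-Lie algebra. -/
def lieC (br star : h →ₗ[K] h →ₗ[K] h) : h →ₗ[K] h →ₗ[K] h :=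
  LinearMap.mk₂ K (fun u v => star u v - star v u + br u v)
    (by intro u u' v; simp only [map_add, LinearMap.add_apply]; abel)
    (by intro r u v; simp [map_smul, smul_sub, smul_add])
    (by intro u v v'; simp only [map_add, LinearMap.add_apply]; abel)
    (by intro r u v; simp [map_smul, smul_sub, smul_add])

/-- The ternary product `{u,v,w} = α(w) ⋆ (v ⋆ u)` induced by a Hom-post-Lie algebra. -/
def postAlgTb (star : h →ₗ[K] h →ₗ[K] h) (α : h →ₗ[K] h) :
    h →ₗ[K] h →ₗ[K] h →ₗ[K] h :=
  LinearMap.mk₂ K (fun u v =>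
    { toFun := fun w => star (α w) (star v u)
      map_add' := by intro w w'; simp [map_add]
      map_smul' := by intro r w; simp [map_smul] })
    (by
      intro u u' v
      refine LinearMap.ext fun w => ?_
      dsimp
      simp [map_add])
    (by
      intro r u v
      refine LinearMap.ext fun w => ?_
      dsimp
      simp [map_smul])
    (by
      intro u v v'
      refine LinearMap.ext fun w => ?_
      dsimp
      simp [map_add])
    (by
      intro r u v
      refine LinearMap.ext fun w => ?_
      dsimp
      simp [map_smul])

end Defs

variable {K : Type*} [Field K] {g h : Type*} [AddCommGroup g] [Module K g]
  [AddCommGroup h] [Module K h]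

/-- `A` is a `κ`-weighted `𝒪`-operator iff `N_A = (id, A; 0, 0)` is a Nijenhuis operator
on the semidirect product `g ⋉_θ h`. -/
theorem oOperator_iff_nijenhuis (brg : g →ₗ[K] g →ₗ[K] g →ₗ[K] g) (αg : g →ₗ[K] g)
    (brh : h →ₗ[K] h →ₗ[K] h →ₗ[K] h) (αh : h →ₗ[K] h)
    (θ : g →ₗ[K] g →ₗ[K] Module.End K h) (κ : K) (A : h →ₗ[K] g)
    (hg : IsHomLts K brg αg) (hh : IsHomLts K brh αh)
    (hθ : IsAction K brg αg brh αh θ) :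
    IsOOperator K brg αg brh αh θ κ A ↔
      IsNijenhuis K (sdBr K brg brh θ κ) (αg.prodMap αh)
        (LinearMap.inl K g h ∘ₗ (LinearMap.fst K g h + A ∘ₗ LinearMap.snd K g h)) := by
  constructor
  · rintro ⟨hα, hA⟩
    refine ⟨fun p => Prod.ext (by simp [hα]) (by simp), ?_⟩
    rintro ⟨x, u⟩ ⟨y, v⟩ ⟨z, w⟩
    have key := hA u v w
    refine Prod.ext ?_ ?_
    · simp [sdBr] at key ⊢
      rw [key]
      abel
    · simp [sdBr]
  · rintro ⟨hα, hN⟩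
    refine ⟨fun u => ?_, fun u v w => ?_⟩
    · simpa using congrArg Prod.fst (hα (0, u))
    · have key := congrArg Prod.fst (hN (0, u) (0, v) (0, w))
      simp [sdBr] at key ⊢
      rw [key]
      abel
end

section
/- Under the induced representation θ_A, the associated map D_A(u,v) = θ_A(v,u) − θ_A(u,v) is given explicitly by D_A(u,v)(x) = [Au, Av, x]_g + A(θ(Au, x)v − θ(Av, x)u) for all u,v ∈ h and x ∈ g. -/
open Finset

variable {K : Type*} [Field K] {g h : Type*} [AddCommGroup g] [Module K g]
  [AddCommGroup h] [Module K h]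

/-- `D_A(u,v)(x) = [Au,Av,x]_g + A(θ(Au,x)v - θ(Av,x)u)`. -/
theorem dA_explicit (brg : g →ₗ[K] g →ₗ[K] g →ₗ[K] g) (αg : g →ₗ[K] g)
    (brh : h →ₗ[K] h →ₗ[K] h →ₗ[K] h) (αh : h →ₗ[K] h)
    (θ : g →ₗ[K] g →ₗ[K] Module.End K h) (κ : K) (A : h →ₗ[K] g)
    (hg : IsHomLts K brg αg) (hh : IsHomLts K brh αh)
    (hθ : IsAction K brg αg brh αh θ)
    (hA : IsOOperator K brg αg brh αh θ κ A) :
    ∀ (u v : h) (x : g),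
      thetaA K brg θ A v u x - thetaA K brg θ A u v x
        = brg (A u) (A v) x + A (θ (A u) x v - θ (A v) x u) := by
  intro u v x
  have cyclic := hg.2.2.1 (A u) (A v) x
  have antisymm := hg.2.1 (A v) x (A u)
  simp only [thetaA, LinearMap.mk₂_apply, LinearMap.coe_mk, AddHom.coe_mk, map_add, map_sub]
  rw [eq_neg_of_add_eq_zero_left antisymm] at cyclic
  rw [← sub_eq_zero, ← neg_eq_zero, ← cyclic]
  abel
end

section
/- Let A: h → g be a κ-weighted O-operator between regular Hom-Lie triple systems with respect to an action θ, and let a, b ∈ g satisfy α_g(a) = a and α_g(b) = b. Define ℑ(a,b): h → g by ℑ(a,b)v = A(D(a,b)α_h^{-1}(v)) − [a, b, A α_h^{-1}(v)]_g. Then ℑ(a,b) is a 1-cocycle on the Hom-Lie triple system (h, {-,-,-}_A, α_h) with coefficients in the representation (g, α_g; θ_A); that is, α_g(ℑ(a,b)v) = ℑ(a,b)(α_h(v)) and θ_A(v₂,v₃)ℑ(a,b)v₁ − θ_A(v₁,v₃)ℑ(a,b)v₂ + D_A(v₁,v₂)ℑ(a,b)v₃ − ℑ(a,b){v₁,v₂,v₃}_A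 = 0. -/
open Finset

variable {K : Type*} [Field K] {g h : Type*} [AddCommGroup g] [Module K g]
  [AddCommGroup h] [Module K h]

set_option maxHeartbeats 1000000 in
/-- For regular Hom-Lie triple systems and `a, b` fixed by `αg`, the map
`ℑ(a,b)v = A(D(a,b)αh⁻¹(v)) - [a,b,A αh⁻¹(v)]_g` is a 1-cocycle for `(h,{-,-,-}_A,αh)`
with coefficients in `(g, αg; θ_A)`. -/
theorem im_is_one_cocycle (brg : g →ₗ[K] g →ₗ[K] g →ₗ[K] g) (αg : g →ₗ[K] g)
    (brh : h →ₗ[K] h →ₗ[K] h →ₗ[K] h) (αh : h →ₗ[K] h)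
    (θ : g →ₗ[K] g →ₗ[K] Module.End K h) (κ : K) (A : h →ₗ[K] g)
    (hg : IsHomLts K brg αg) (hh : IsHomLts K brh αh)
    (hθ : IsAction K brg αg brh αh θ)
    (hA : IsOOperator K brg αg brh αh θ κ A)
    (αginv : g →ₗ[K] g) (hαg1 : ∀ x, αginv (αg x) = x) (hαg2 : ∀ x, αg (αginv x) = x)
    (αhinv : h →ₗ[K] h) (hαh1 : ∀ u, αhinv (αh u) = u) (hαh2 : ∀ u, αh (αhinv u) = u)
    (a b : g) (ha : αg a = a) (hb : αg b = b)
    (Im : h → g)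
    (hIm : ∀ v, Im v = A (θ b a (αhinv v) - θ a b (αhinv v)) - brg a b (A (αhinv v))) :
    (∀ v, αg (Im v) = Im (αh v)) ∧
    (∀ v₁ v₂ v₃ : h,
      thetaA K brg θ A v₂ v₃ (Im v₁) - thetaA K brg θ A v₁ v₃ (Im v₂)
        + (thetaA K brg θ A v₂ v₁ (Im v₃) - thetaA K brg θ A v₁ v₂ (Im v₃))
        - Im (brA K brh θ κ A v₁ v₂ v₃) = 0) := by
  obtain ⟨hgα, hgs, hgc, hgf⟩ := hg
  obtain ⟨hhα, -, -, -⟩ := hh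
  obtain ⟨⟨hθα, -, hθD⟩, hθder, -, -⟩ := hθ
  obtain ⟨hAα, hAO⟩ := hA
  have hImα : ∀ u, Im (αh u) = A (θ b a u - θ a b u) - brg a b (A u) := by
    intro u
    rw [hIm, hαh1]
  have hθba : ∀ u, αh (θ b a u) = θ b a (αh u) := by
    intro u
    rw [← hθα, ha, hb]
  have hθab : ∀ u, αh (θ a b u) = θ a b (αh u) := by
    intro u
    rw [← hθα, ha, hb]
  refine ⟨fun v => ?_, fun v₁ v₂ v₃ => ?_⟩
  · rw [hImα, hIm, map_sub, ← hAα, hgα, ha, hb, map_sub, hθba, hθab, ← hAα, hαh2]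
  obtain ⟨u₁, rfl⟩ : ∃ u, αh u = v₁ := ⟨_, hαh2 v₁⟩
  obtain ⟨u₂, rfl⟩ : ∃ u, αh u = v₂ := ⟨_, hαh2 v₂⟩
  obtain ⟨u₃, rfl⟩ : ∃ u, αh u = v₃ := ⟨_, hαh2 v₃⟩
  have hbrA : ∀ u v w, brA K brh θ κ A u v w = θ (A v) (A u) w - θ (A u) (A v) w
      - θ (A u) (A w) v + θ (A v) (A w) u + κ • brh u v w := fun _ _ _ => rfl
  have hθA : ∀ u v x, thetaA K brg θ A u v x =
      brg x (A u) (A v) + A (θ x (A v) u - θ (A u) x v + θ x (A u) v) := fun _ _ _ => rfl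
  have hbrAα : brA K brh θ κ A (αh u₁) (αh u₂) (αh u₃) = αh (brA K brh θ κ A u₁ u₂ u₃) := by
    simp only [hbrA, hAα, hθα, hhα, map_add, map_sub, map_smul]
  -- `D(a,b)` commutes with `θ` up to the inner derivation `[a,b,-]`.
  have hcomm : ∀ p q v, θ b a (θ p q v) - θ a b (θ p q v) =
      θ (αg p) (αg q) (θ b a v - θ a b v)
        + θ (brg a b p) (αg q) (αh v) + θ (αg p) (brg a b q) (αh v) := by
    intro p q v
    have := hθD p q a b v
    rw [ha, hb] at this
    rw [map_sub]
    linear_combination (norm := module) -this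
  have hder : ∀ u v w, θ b a (brh u v w) - θ a b (brh u v w) =
      brh (θ b a u - θ a b u) (αh v) (αh w) + brh (αh u) (θ b a v - θ a b v) (αh w)
        + brh (αh u) (αh v) (θ b a w - θ a b w) := by
    intro u v w
    have h₁ := hθder b a u v w
    have h₂ := hθder a b u v w
    rw [ha, hb] at h₁ h₂
    simp only [map_sub, LinearMap.sub_apply]
    linear_combination (norm := module) h₁ - h₂
  have hfund : brg a b (A (brA K brh θ κ A u₁ u₂ u₃)) =
      brg (brg a b (A u₁)) (A (αh u₂)) (A (αh u₃))
        + brg (A (αh u₁)) (brg a b (A u₂)) (A (αh u₃))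
        + brg (A (αh u₁)) (A (αh u₂)) (brg a b (A u₃)) := by
    have := hgf a b (A u₁) (A u₂) (A u₃)
    rwa [ha, hb, hAO, ← hAα, ← hAα, ← hAα] at this
  have hc₁ := congrArg A (hcomm (A u₂) (A u₁) u₃)
  have hc₂ := congrArg A (hcomm (A u₁) (A u₂) u₃)
  have hc₃ := congrArg A (hcomm (A u₁) (A u₃) u₂)
  have hc₄ := congrArg A (hcomm (A u₂) (A u₃) u₁)
  have hd := congrArg A (hder u₁ u₂ u₃)
  have ho₁ := hAO (θ b a u₁ - θ a b u₁) (αh u₂) (αh u₃)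
  have ho₂ := hAO (αh u₁) (θ b a u₂ - θ a b u₂) (αh u₃)
  have ho₃ := hAO (αh u₁) (αh u₂) (θ b a u₃ - θ a b u₃)
  have hs := hgs (αg (A u₁)) (Im (αh u₂)) (αg (A u₃))
  have hs' := hgs (αg (A u₂)) (Im (αh u₃)) (αg (A u₁))
  have hcyc := hgc (αg (A u₁)) (αg (A u₂)) (Im (αh u₃))
  rw [hbrAα, hImα (brA _ _ _ _ _ _ _ _)]
  simp only [hθA, hImα, hbrA, hAα, map_sub, map_add, map_smul, LinearMap.sub_apply, smul_sub]
    at hc₁ hc₂ hc₃ hc₄ hd ho₁ ho₂ ho₃ hs hs' hcyc hfund ⊢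
  linear_combination (norm := module) ho₁ + ho₂ + ho₃ - hs + hs' - hcyc - hc₁ + hc₂ + hc₃ - hc₄
    - κ • hd + hfund
end

section
/- If A + tA₁ is a linear deformation of a κ-weighted O-operator A (i.e., A_t = A + tA₁ is a κ-weighted O-operator for the truncated polynomial parameter t with t² = 0), then A₁ is a 1-cocycle on the Hom-Lie triple system (h, {-,-,-}_A, α_h) with coefficients in the representation (g, α_g; θ_A): namely α_g∘A₁ = A₁∘α_h and θ_A(v₂,v₃)A₁(v₁) − θ_A(v₁,v₃)A₁(v₂) + D_A(v₁,v₂)A₁(v₃) = A₁({v₁,v₂,v₃}_A) for all v₁,v₂,v₃ ∈ h. -/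
open Finset

variable {K : Type*} [Field K] {g h : Type*} [AddCommGroup g] [Module K g]
  [AddCommGroup h] [Module K h]

/-- The infinitesimal `A₁` of a linear deformation `A + tA₁` (with `t² = 0`) of a
`κ`-weighted `𝒪`-operator `A` is a 1-cocycle with coefficients in `(g, αg; θ_A)`. -/
theorem linear_deformation_infinitesimal_is_cocycle
    (brg : g →ₗ[K] g →ₗ[K] g →ₗ[K] g) (αg : g →ₗ[K] g)
    (brh : h →ₗ[K] h →ₗ[K] h →ₗ[K] h) (αh : h →ₗ[K] h)
    (θ : g →ₗ[K] g →ₗ[K] Module.End K h) (κ : K) (A : h →ₗ[K] g)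
    (hg : IsHomLts K brg αg) (hh : IsHomLts K brh αh)
    (hθ : IsAction K brg αg brh αh θ)
    (hA : IsOOperator K brg αg brh αh θ κ A)
    (A₁ : h →ₗ[K] g)
    -- `A + t A₁` commutes with the twist maps: the `t`-coefficient
    (hdef₁ : ∀ u, A₁ (αh u) = αg (A₁ u))
    -- the coefficient of `t` in the `κ`-weighted `𝒪`-operator identity for `A + t A₁`
    (hdef₂ : ∀ u v w : h,
      brg (A₁ u) (A v) (A w) + brg (A u) (A₁ v) (A w) + brg (A u) (A v) (A₁ w)
      = A₁ (θ (A v) (A u) w - θ (A u) (A v) w - θ (A u) (A w) v + θ (A v) (A w) u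
          + κ • brh u v w)
        + A (θ (A₁ v) (A u) w + θ (A v) (A₁ u) w - θ (A₁ u) (A v) w - θ (A u) (A₁ v) w
          - θ (A₁ u) (A w) v - θ (A u) (A₁ w) v + θ (A₁ v) (A w) u + θ (A v) (A₁ w) u)) :
    (∀ u, αg (A₁ u) = A₁ (αh u)) ∧
    (∀ v₁ v₂ v₃ : h,
      thetaA K brg θ A v₂ v₃ (A₁ v₁) - thetaA K brg θ A v₁ v₃ (A₁ v₂)
        + (thetaA K brg θ A v₂ v₁ (A₁ v₃) - thetaA K brg θ A v₁ v₂ (A₁ v₃))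
        = A₁ (brA K brh θ κ A v₁ v₂ v₃)) := by
  obtain ⟨-, hskew, hcyc, -⟩ := hg
  refine ⟨fun u => (hdef₁ u).symm, fun u v w => ?_⟩
  have hA₁ : A₁ (brA K brh θ κ A u v w) = _ := (eq_sub_of_add_eq (hdef₂ u v w).symm)
  have h₁ := eq_neg_of_add_eq_zero_left (hskew (A u) (A₁ v) (A w))
  have h₂ := eq_neg_of_add_eq_zero_left (hskew (A v) (A₁ w) (A u))
  have h₃ : brg (A u) (A v) (A₁ w)
      = brg (A₁ w) (A v) (A u) - brg (A₁ w) (A u) (A v) := by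
    have h₄ := hcyc (A u) (A v) (A₁ w)
    rw [h₂, add_assoc] at h₄
    rw [eq_neg_of_add_eq_zero_left h₄]
    abel
  rw [hA₁, h₁, h₃]
  simp only [thetaA, LinearMap.mk₂_apply, LinearMap.coe_mk, AddHom.coe_mk, map_add, map_sub]
  abel
end

section
/- Let A: h → g be a κ-weighted O-operator from a Hom-Lie triple system (h,[-,-,-]_h,α_h) to a Hom-Lie triple system (g,[-,-,-]_g,α_g) with respect to an action θ. Define ⌊u,v,w⌋ = κ[u,v,w]_h and {u,v,w} = θ(Av,Aw)u. Then (h, ⌊-,-,-⌋, {-,-,-}, α_h) is a Hom-post-Lie triple system. -/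
open Finset

variable {K : Type*} [Field K] {g h : Type*} [AddCommGroup g] [Module K g]
  [AddCommGroup h] [Module K h]

/-- Scaling the bracket of a Hom-Lie triple system gives a Hom-Lie triple system. -/
theorem IsHomLts.smul {br : g →ₗ[K] g →ₗ[K] g →ₗ[K] g} {α : g →ₗ[K] g}
    (hbr : IsHomLts K br α) (κ : K) : IsHomLts K (κ • br) α := by
  obtain ⟨hmul, hanti, hcyc, hfund⟩ := hbr
  refine ⟨fun x y z => ?_, fun x y z => ?_, fun x y z => ?_, fun a b x y z => ?_⟩
  · simp [hmul]
  · simp only [LinearMap.smul_apply, ← smul_add, hanti, smul_zero]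
  · simp only [LinearMap.smul_apply, ← smul_add, hcyc, smul_zero]
  · simp only [LinearMap.smul_apply, map_smul, ← smul_add]
    rw [hfund]

@[simp]
theorem postTb_apply (θ : g →ₗ[K] g →ₗ[K] Module.End K h) (A : h →ₗ[K] g) (u v w : h) :
    postTb K θ A u v w = θ (A v) (A w) u := rfl

/-- A weighted `𝒪`-operator sends the adjacent bracket to the bracket of `g`. -/
theorem IsOOperator.map_pC {brg : g →ₗ[K] g →ₗ[K] g →ₗ[K] g} {αg : g →ₗ[K] g}
    {brh : h →ₗ[K] h →ₗ[K] h →ₗ[K] h} {αh : h →ₗ[K] h}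
    {θ : g →ₗ[K] g →ₗ[K] Module.End K h} {κ : K} {A : h →ₗ[K] g}
    (hA : IsOOperator K brg αg brh αh θ κ A) (u v w : h) :
    A (pC K (κ • brh) (postTb K θ A) u v w) = brg (A u) (A v) (A w) := by
  rw [hA.2, pC, pD]
  simp only [postTb_apply, LinearMap.smul_apply]
  congr 1
  abel

/-- A `κ`-weighted `𝒪`-operator induces a Hom-post-Lie triple system structure on `h` with
`⌊u,v,w⌋ = κ[u,v,w]_h` and `{u,v,w} = θ(Av,Aw)u`. -/
theorem oOperator_induces_homPostLts (brg : g →ₗ[K] g →ₗ[K] g →ₗ[K] g) (αg : g →ₗ[K] g)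
    (brh : h →ₗ[K] h →ₗ[K] h →ₗ[K] h) (αh : h →ₗ[K] h)
    (θ : g →ₗ[K] g →ₗ[K] Module.End K h) (κ : K) (A : h →ₗ[K] g)
    (hg : IsHomLts K brg αg) (hh : IsHomLts K brh αh)
    (hθ : IsAction K brg αg brh αh θ)
    (hA : IsOOperator K brg αg brh αh θ κ A) :
    IsHomPostLts K (κ • brh) (postTb K θ A) αh := by
  obtain ⟨⟨hβ, hθθ, hDθ⟩, -, hvan, hvan'⟩ := hθ
  have hAα := hA.1
  refine ⟨hh.smul κ, fun u v w => ?_, fun u v w s t => ?_, fun u v w s t => ?_,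
    fun u v w s t => ?_, fun u v w s t => ?_⟩
  · simp [hAα, hβ]
  · simp only [postTb_apply, pD, hA.map_pC, hAα]
    rw [← sub_eq_zero, ← neg_eq_zero, ← hθθ (A s) (A t) (A v) (A w) u]
    abel
  · simp only [postTb_apply, pD, hA.map_pC, hAα, map_sub,
      LinearMap.sub_apply]
    rw [← sub_eq_zero, ← neg_eq_zero, ← hDθ (A s) (A t) (A u) (A v) w]
    abel
  · simp [hAα, hvan]
  · simp [hvan']
end

section
/- Let (h, [-,-], ⋆, α) be a Hom-post-Lie algebra. Then (h, [-,-]_C, α) with [u,v]_C = u⋆v − v⋆u + [u,v] is a Hom-Lie algebra. -/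
open Finset

/-- The adjacent bracket `[u,v]_C = u⋆v - v⋆u + [u,v]` of a Hom-post-Lie algebra is a
Hom-Lie algebra structure. -/
theorem adjacent_homLie {K : Type*} [Field K] {h : Type*} [AddCommGroup h] [Module K h]
    (br star : h →ₗ[K] h →ₗ[K] h) (α : h →ₗ[K] h)
    (hpost : IsHomPostLie K br star α) :
    IsHomLie K (lieC K br star) α := by
  obtain ⟨⟨hskew, hmul, hjac⟩, hstar, -, hassoc, hstar_br, hbr_star⟩ := hpost
  have lieC_apply (u v : h) : lieC K br star u v = star u v - star v u + br u v := rfl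
  have hbr_star' (u v w : h) : br (α w) (star u v) = 0 := by
    rw [hskew, hbr_star, neg_zero]
  have hassoc' (u v w : h) : star (lieC K br star u v) (α w)
      = star (α u) (star v w) - star (α v) (star u w) := by
    rw [← hassoc, lieC_apply]
    congr 2
    abel
  have lieC_lieC (x y z : h) : lieC K br star (α x) (lieC K br star y z)
      = star (α x) (star y z) - star (α x) (star z y)
        - (star (α y) (star z x) - star (α z) (star y x)) + br (α x) (br y z) := by
    rw [lieC_apply (α x), hassoc', lieC_apply]
    simp only [map_add, map_sub, hstar_br, hbr_star', sub_zero, add_zero, zero_add]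
  refine ⟨fun x y => ?_, fun x y => ?_, fun x y z => ?_⟩
  · rw [lieC_apply, lieC_apply, hskew x y]
    abel
  · simp only [lieC_apply, map_add, map_sub, hstar, hmul]
  · rw [lieC_lieC, lieC_lieC, lieC_lieC, ← hjac x y z]
    abel
end
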